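/- Let m, n, n' be real numbers with m ≥ 2 and 2 ≤ n < n'. If p ∈ (0,1) satisfies 1 − (1 − p^n)^m = p and p' ∈ (0,1) satisfies 1 − (1 − p'^{n'})^m = p', then p' > p. That is, the critical probability p_c(m,n) of the diamond fractal D(m,n) is strictly increasing in the number of subdivisions n. -/

import Mathlib

theorem diamond_slope_form (m n c : ℝ) (hc0 : 0 < c) :
    m * n * c ^ (n - 1) * (1 - c) - (1 - c ^ n)
      = c ^ n * (m * n * (c⁻¹ - 1) - ((c⁻¹) ^ n - 1)) := by
  have h1 : 0 < c ^ n := Real.rpow_pos_of_pos hc0 n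
  rw [Real.rpow_sub_one hc0.ne', Real.inv_rpow hc0.le]
  field_simp

theorem diamond_deriv (m n c : ℝ) (hn : 2 ≤ n) (hc0 : 0 ≤ c) (hc1 : c < 1) :
    HasDerivAt (fun x : ℝ => Real.log (1 - x) - m * Real.log (1 - x ^ n))
      ((m * n * c ^ (n - 1) * (1 - c) - (1 - c ^ n)) / ((1 - c) * (1 - c ^ n))) c := by
  have h1 : c ^ n < 1 := Real.rpow_lt_one hc0 hc1 (by linarith)
  have a1 : 1 - c ≠ 0 := by linarith
  have a2 : 1 - c ^ n ≠ 0 := by linarith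
  have d1 : HasDerivAt (fun x : ℝ => Real.log (1 - x)) (-1 / (1 - c)) c :=
    ((hasDerivAt_id c).const_sub 1).log a1
  have d2 : HasDerivAt (fun x : ℝ => Real.log (1 - x ^ n)) (-(n * c ^ (n - 1)) / (1 - c ^ n)) c :=
    ((Real.hasDerivAt_rpow_const (Or.inr (by linarith))).const_sub 1).log a2
  refine (d1.sub (d2.const_mul m)).congr_deriv ?_
  field_simp
  ring

/-- Let `m, n, n'` be real numbers with `m ≥ 2` and `2 ≤ n < n'`. If `p ∈ (0,1)` satisfies
`1 − (1 − p^n)^m = p` and `p' ∈ (0,1)` satisfies `1 − (1 − p'^{n'})^m = p'`, then `p' > p`: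
the critical probability of `D(m,n)` is strictly increasing in the number of subdivisions `n`.
(Here powers are real powers.) -/
theorem diamond_pc_increasing_in_subdivisions (m n n' : ℝ) (hm : 2 ≤ m) (hn : 2 ≤ n)
    (hnn' : n < n') (p p' : ℝ) (hp : p ∈ Set.Ioo (0 : ℝ) 1) (hp' : p' ∈ Set.Ioo (0 : ℝ) 1)
    (hfix : 1 - (1 - p ^ n) ^ m = p) (hfix' : 1 - (1 - p' ^ n') ^ m = p') :
    p' > p := by
  by_contra hcon
  have hle : p' ≤ p := not_lt.mp hcon
  obtain ⟨hp0, hp1⟩ := hp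
  obtain ⟨hq0, hq1⟩ := hp'
  have hlt : p' ^ n' < p' ^ n := Real.rpow_lt_rpow_of_exponent_gt hq0 hq1 hnn'
  have b1 : p' ^ n < 1 := Real.rpow_lt_one hq0.le hq1 (by linarith)
  have b2 : p ^ n < 1 := Real.rpow_lt_one hp0.le hp1 (by linarith)
  have e1 : Real.log (1 - p) - m * Real.log (1 - p ^ n) = 0 := by
    rw [← Real.log_rpow (by linarith), show (1 - p ^ n) ^ m = 1 - p by linarith, sub_self]
  have e2 : Real.log (1 - p') - m * Real.log (1 - p' ^ n') = 0 := by
    rw [← Real.log_rpow (by linarith), show (1 - p' ^ n') ^ m = 1 - p' by linarith, sub_self]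
  have e3 : 0 < Real.log (1 - p') - m * Real.log (1 - p' ^ n) := by
    have : Real.log (1 - p' ^ n) < Real.log (1 - p' ^ n') :=
      Real.log_lt_log (by linarith) (by linarith)
    nlinarith
  have hlt' : p' < p := by
    rcases hle.lt_or_eq with h | h
    · exact h
    · subst h; linarith
  have e0 : Real.log (1 - 0) - m * Real.log (1 - (0 : ℝ) ^ n) = 0 := by
    rw [Real.zero_rpow (by linarith)]; simp
  obtain ⟨c, ⟨hc0, hc1⟩, hc⟩ := exists_hasDerivAt_eq_slope
    (fun x : ℝ => Real.log (1 - x) - m * Real.log (1 - x ^ n)) _ hq0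
    (fun x hx => (diamond_deriv m n x hn hx.1 (by linarith [hx.2])).continuousAt.continuousWithinAt)
    (fun x hx => diamond_deriv m n x hn hx.1.le (by linarith [hx.2]))
  obtain ⟨d, ⟨hd0, hd1⟩, hd⟩ := exists_hasDerivAt_eq_slope
    (fun x : ℝ => Real.log (1 - x) - m * Real.log (1 - x ^ n)) _ hlt'
    (fun x hx => (diamond_deriv m n x hn (by linarith [hx.1])
      (by linarith [hx.2])).continuousAt.continuousWithinAt)
    (fun x hx => diamond_deriv m n x hn (by linarith [hx.1]) (by linarith [hx.2]))
  simp only [e1, zero_sub] at hd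
  simp only [e0] at hc
  simp only [sub_zero] at hc
  have hdp : 0 < d := by linarith
  have c1 : c ^ n < 1 := Real.rpow_lt_one hc0.le (by linarith) (by linarith)
  have d1 : d ^ n < 1 := Real.rpow_lt_one hdp.le (by linarith) (by linarith)
  have hc2 := div_pos e3 hq0
  rw [← hc, diamond_slope_form m n c hc0,
    div_pos_iff_of_pos_right (mul_pos (by linarith) (by linarith)),
    mul_pos_iff_of_pos_left (Real.rpow_pos_of_pos hc0 n)] at hc2
  have hd2 := div_neg_of_neg_of_pos (neg_neg_of_pos e3) (sub_pos.mpr hlt')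
  rw [← hd, diamond_slope_form m n d hdp,
    div_lt_iff₀ (mul_pos (by linarith) (by linarith)), zero_mul] at hd2
  replace hd2 := (pos_iff_neg_of_mul_neg hd2).mp (Real.rpow_pos_of_pos hdp n)
  have y2 : 1 < d⁻¹ := (one_lt_inv₀ hdp).mpr (by linarith)
  have y1 : d⁻¹ < c⁻¹ := (inv_lt_inv₀ hdp hc0).mpr (by linarith)
  have key := (convexOn_rpow (show 1 ≤ n by linarith)).secant_mono
    (a := 1) (x := d⁻¹) (y := c⁻¹) (by simp) (by simp [hdp.le]) (by simp [hc0.le])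
    (by linarith) (by linarith) y1.le
  simp only [Real.one_rpow] at key
  have k1 : m * n < ((d⁻¹) ^ n - 1) / (d⁻¹ - 1) := by
    rw [lt_div_iff₀ (by linarith)]; linarith
  have k2 : ((c⁻¹) ^ n - 1) / (c⁻¹ - 1) < m * n := by
    rw [div_lt_iff₀ (by linarith)]; linarith
  linarith
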